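/- There exist ε > 0, C > 1 and a natural number N such that for every n ≥ N the following holds. Let G be an n-vertex (p,β)-jumbled simple graph with δ(G) ≥ (1−ε)np, where p ≥ C·log(n)/n and β ≤ ε·np. Suppose R ⊆ E(G) satisfies e_R(A,B) ≥ e_G(A,B)/2 for every partition V(G) = A ∪ B. Then for every vertex set S with |S| ≤ 2·log(n) and every two vertices v, w ∉ S, there is a path from v to w of length at most log(n) − 1 using only edges of R and avoiding S. -/

import Mathlib

open SimpleGraph

/-- The number of edges of `G` with both endpoints inside `U`. -/
noncomputable def interiorEdgeCount {V : Type} (G : SimpleGraph V) (U : Set V) : ℕ :=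
  {e ∈ G.edgeSet | ∀ v ∈ e, v ∈ U}.ncard

/-- `G` is `(p, β)`-jumbled: `0 < p < 1 ≤ β` and for every vertex subset `U`,
`|e_G(U) - p * binom(|U|, 2)| ≤ β * |U|`. -/
def IsJumbled {V : Type} (G : SimpleGraph V) (p β : ℝ) : Prop :=
  0 < p ∧ p < 1 ∧ 1 ≤ β ∧
    ∀ U : Set V,
      |(interiorEdgeCount G U : ℝ) - p * (Nat.choose U.ncard 2 : ℕ)| ≤ β * U.ncard

/-- The number of edges in the edge set `E` with one endpoint in `A` and the other in `B`. -/
noncomputable def edgeCountBetween {V : Type} (E : Set (Sym2 V)) (A B : Set V) : ℕ :=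
  {e ∈ E | ∃ a ∈ A, ∃ b ∈ B, e = s(a, b)}.ncard

/-- The vertices reachable from `v` by a walk of length at most `i` with all edges in `R` and
no vertex in `S`. -/
def restrictedBall {V : Type} (G : SimpleGraph V) (R : Set (Sym2 V)) (S : Set V) (v : V) (i : ℕ) :
    Set V :=
  {x | ∃ q : G.Walk v x, (∀ e ∈ q.edges, e ∈ R) ∧ (∀ u ∈ q.support, u ∉ S) ∧ q.length ≤ i}

/-- The vertices outside `U` joined to `U` by an element of `R`. -/
def outerNeighbors {V : Type} (R : Set (Sym2 V)) (U : Set V) : Set V :=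
  {x | x ∉ U ∧ ∃ y ∈ U, s(y, x) ∈ R}

lemma mem_restrictedBall_self {V : Type} (G : SimpleGraph V) (R : Set (Sym2 V)) {S : Set V} {v : V}
    (hv : v ∉ S) (i : ℕ) : v ∈ restrictedBall G R S v i :=
  ⟨Walk.nil, by simp, by simpa using hv, by simp⟩

lemma restrictedBall_subset_succ {V : Type} (G : SimpleGraph V) {R : Set (Sym2 V)}
    (hR : R ⊆ G.edgeSet) (S : Set V) (v : V) (i : ℕ) :
    (restrictedBall G R S v i ∪ outerNeighbors R (restrictedBall G R S v i)) \ S ⊆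
      restrictedBall G R S v (i + 1) := by
  rintro x ⟨hx | ⟨-, y, ⟨q, hq, hqS, hl⟩, hyx⟩, hxS⟩
  · obtain ⟨q, hq, hqS, hl⟩ := hx
    exact ⟨q, hq, hqS, by omega⟩
  · have hadj : G.Adj y x := by simpa using hR hyx
    refine ⟨q.concat hadj, ?_, ?_, ?_⟩
    · intro e he
      rw [Walk.edges_concat, List.concat_eq_append, List.mem_append, List.mem_singleton] at he
      rcases he with he | rfl
      · exact hq e he
      · exact hyx
    · intro u hu
      rw [Walk.support_concat, List.mem_append, List.mem_singleton] at hu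
      rcases hu with hu | rfl
      · exact hqS u hu
      · exact hxS
    · simpa using hl

lemma edgeCountBetween_compl_le {V : Type} [Finite V] {G : SimpleGraph V} {R : Set (Sym2 V)}
    (hR : R ⊆ G.edgeSet) (U : Set V) :
    edgeCountBetween R U Uᶜ ≤ edgeCountBetween G.edgeSet U (outerNeighbors R U) := by
  apply Set.ncard_le_ncard
  · rintro e ⟨he, a, ha, b, hb, rfl⟩
    exact ⟨hR he, a, ha, b, ⟨hb, a, ha, he⟩, rfl⟩
  · exact Set.toFinite _

lemma edgeCountBetween_add_interiorEdgeCount_le {V : Type} [Finite V] (G : SimpleGraph V)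
    {U T : Set V} (h : Disjoint U T) :
    edgeCountBetween G.edgeSet U T + interiorEdgeCount G U ≤ interiorEdgeCount G (U ∪ T) := by
  unfold edgeCountBetween interiorEdgeCount
  rw [← Set.ncard_union_eq _ (Set.toFinite _) (Set.toFinite _)]
  · apply Set.ncard_le_ncard _ (Set.toFinite _)
    rintro e (⟨he, a, ha, b, hb, rfl⟩ | ⟨he, h2⟩)
    · refine ⟨he, fun v hv => ?_⟩
      rcases Sym2.mem_iff.1 hv with rfl | rfl
      · exact Or.inl ha
      · exact Or.inr hb
    · exact ⟨he, fun v hv => Or.inl (h2 v hv)⟩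
  · rw [Set.disjoint_left]
    rintro e ⟨he, a, ha, b, hb, rfl⟩ ⟨-, h2⟩
    exact Set.disjoint_left.1 h (h2 b (by simp)) hb

lemma sum_ncard_neighborSet_le {V : Type} [Fintype V] (G : SimpleGraph V) (U : Finset V) :
    ∑ v ∈ U, (G.neighborSet v).ncard ≤
      edgeCountBetween G.edgeSet (U : Set V) (U : Set V)ᶜ +
        2 * interiorEdgeCount G (U : Set V) := by
  classical
  have hdeg : ∀ v ∈ U, (G.neighborSet v).ncard =
      (Uᶜ.filter (G.Adj v)).card + (U.filter (G.Adj v)).card := by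
    intro v _
    rw [← Finset.card_union_of_disjoint (Finset.disjoint_filter_filter disjoint_compl_left),
      ← Finset.filter_union, ← Set.ncard_coe_finset]
    congr 1
    ext x
    simp [or_comm, em]
  rw [Finset.sum_congr rfl hdeg, Finset.sum_add_distrib]
  refine add_le_add ?_ ?_
  · rw [← Finset.card_sigma, ← Set.ncard_coe_finset]
    apply Set.ncard_le_ncard_of_injOn (fun x => s(x.1, x.2)) _ _ (Set.toFinite _)
    · rintro ⟨a, b⟩ hab
      simp only [Finset.coe_sigma, Set.mem_sigma_iff, Finset.mem_coe, Finset.mem_filter,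
        Finset.mem_compl] at hab
      exact ⟨hab.2.2, a, hab.1, b, hab.2.1, rfl⟩
    · rintro ⟨a, b⟩ hab ⟨c, d⟩ hcd h
      simp only [Finset.coe_sigma, Set.mem_sigma_iff, Finset.mem_coe, Finset.mem_filter,
        Finset.mem_compl] at hab hcd
      simp only [Sym2.eq_iff] at h
      rcases h with ⟨rfl, rfl⟩ | ⟨rfl, rfl⟩
      · rfl
      · exact absurd hab.1 hcd.2.1
  · rw [← Finset.card_sigma]
    refine (Finset.card_le_mul_card_image (f := fun x : (_ : V) × V => s(x.1, x.2)) _ 2 ?_).trans ?_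
    · intro e _
      induction e with
      | _ a b =>
        refine (Finset.card_le_card (t := {⟨a, b⟩, ⟨b, a⟩}) ?_).trans Finset.card_le_two
        rintro ⟨c, d⟩ h
        have h2 := (Finset.mem_filter.1 h).2
        simp only [Sym2.eq_iff] at h2
        rcases h2 with ⟨rfl, rfl⟩ | ⟨rfl, rfl⟩ <;> simp
    · refine Nat.mul_le_mul_left 2 ?_
      rw [← Set.ncard_coe_finset]
      apply Set.ncard_le_ncard _ (Set.toFinite _)
      intro e he
      simp only [Finset.coe_image, Set.mem_image, Finset.mem_coe, Finset.mem_sigma,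
        Finset.mem_filter] at he
      obtain ⟨⟨a, b⟩, ⟨ha, hb, hab⟩, rfl⟩ := he
      refine ⟨hab, fun v hv => ?_⟩
      rcases Sym2.mem_iff.1 hv with rfl | rfl
      · exact ha
      · exact hb

lemma mul_ncard_le_of_isJumbled {V : Type} [Fintype V] {G : SimpleGraph V} {p β d : ℝ}
    (hJ : IsJumbled G p β) (hd : ∀ v : V, d ≤ ((G.neighborSet v).ncard : ℝ))
    {R : Set (Sym2 V)} (hR : R ⊆ G.edgeSet)
    (hcut : ∀ A B : Set V, A ∪ B = Set.univ → Disjoint A B →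
      (edgeCountBetween R A B : ℝ) ≥ (edgeCountBetween G.edgeSet A B : ℝ) / 2) (U : Set V) :
    d * U.ncard ≤ p * ((U ∪ outerNeighbors R U).ncard : ℝ) ^ 2 +
      2 * β * (U ∪ outerNeighbors R U).ncard := by
  classical
  obtain ⟨hp, -, -, hJ⟩ := hJ
  have h1 : d * U.ncard ≤ edgeCountBetween G.edgeSet U Uᶜ + 2 * interiorEdgeCount G U := by
    have h := sum_ncard_neighborSet_le G U.toFinset
    rw [Set.coe_toFinset] at h
    have h' : (∑ v ∈ U.toFinset, ((G.neighborSet v).ncard : ℝ)) ≤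
        edgeCountBetween G.edgeSet U Uᶜ + 2 * interiorEdgeCount G U := by exact_mod_cast h
    have h'' := Finset.card_nsmul_le_sum U.toFinset
      (fun v => ((G.neighborSet v).ncard : ℝ)) d (fun v _ => hd v)
    rw [nsmul_eq_mul, ← Set.ncard_eq_toFinset_card'] at h''
    linarith
  have h2 := hcut U Uᶜ (Set.union_compl_self U) disjoint_compl_right
  have h3 : (edgeCountBetween R U Uᶜ : ℝ) ≤ edgeCountBetween G.edgeSet U (outerNeighbors R U) := by
    exact_mod_cast edgeCountBetween_compl_le hR U
  have h4 : (edgeCountBetween G.edgeSet U (outerNeighbors R U) : ℝ) + interiorEdgeCount G U ≤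
      interiorEdgeCount G (U ∪ outerNeighbors R U) := by
    exact_mod_cast edgeCountBetween_add_interiorEdgeCount_le G
      (U := U) (T := outerNeighbors R U) (Set.disjoint_left.2 fun x hx hx' => hx'.1 hx)
  have h5 := (abs_le.1 (hJ (U ∪ outerNeighbors R U))).2
  rw [Nat.cast_choose_two] at h5
  have h6 : 0 ≤ p * ((U ∪ outerNeighbors R U).ncard : ℝ) := by positivity
  nlinarith

lemma half_le_ncard_outerNeighbors_singleton {V : Type} [Fintype V] {G : SimpleGraph V} {d : ℝ}
    (hd : ∀ v : V, d ≤ ((G.neighborSet v).ncard : ℝ)) {R : Set (Sym2 V)}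
    (hcut : ∀ A B : Set V, A ∪ B = Set.univ → Disjoint A B →
      (edgeCountBetween R A B : ℝ) ≥ (edgeCountBetween G.edgeSet A B : ℝ) / 2) (v : V) :
    d / 2 ≤ (outerNeighbors R {v}).ncard := by
  have h2 := hcut {v} {v}ᶜ (Set.union_compl_self _) disjoint_compl_right
  have h1 : ((G.neighborSet v).ncard : ℝ) ≤ edgeCountBetween G.edgeSet {v} {v}ᶜ := by
    norm_cast
    apply Set.ncard_le_ncard_of_injOn (fun x => s(v, x)) _ _ (Set.toFinite _)
    · intro x hx
      exact ⟨hx, v, rfl, x, fun h => G.ne_of_adj hx h.symm, rfl⟩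
    · intro x _ y _ h
      exact Sym2.congr_right.1 h
  have h3 : (edgeCountBetween R {v} {v}ᶜ : ℝ) ≤ (outerNeighbors R {v}).ncard := by
    norm_cast
    have : {e ∈ R | ∃ a ∈ ({v} : Set V), ∃ b ∈ ({v} : Set V)ᶜ, e = s(a, b)} ⊆
        (fun x => s(v, x)) '' outerNeighbors R {v} := by
      rintro e ⟨he, a, rfl, b, hb, rfl⟩
      exact ⟨b, ⟨hb, a, rfl, he⟩, rfl⟩
    exact (Set.ncard_le_ncard this (Set.toFinite _)).trans (Set.ncard_image_le (Set.toFinite _))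
  linarith [hd v]

/-- The size estimate that turns the edge bound for a set of size `u` into expansion. -/
lemma mul_le_of_edge_bound {n p β u m κ : ℝ} (hn : 0 < n) (hp : 0 < p)
    (hβ : β ≤ 1 / 1000 * n * p) (hu : 0 < u) (hm : 0 ≤ m)
    (h : (1 - 1 / 1000) * n * p * u ≤ p * m ^ 2 + 2 * β * m)
    (hκ : u * κ ^ 2 + 1 / 500 * κ * n < 999 / 1000 * n) : κ * u ≤ m := by
  by_contra! hlt
  have hκ0 : 0 ≤ κ := by
    by_contra! hneg
    nlinarith [mul_neg_of_neg_of_pos hneg hu]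
  have h1 : β * m ≤ 1 / 1000 * n * p * (κ * u) :=
    (mul_le_mul_of_nonneg_right hβ hm).trans
      (mul_le_mul_of_nonneg_left hlt.le (by positivity))
  have h2 : m ^ 2 ≤ (κ * u) ^ 2 := pow_le_pow_left₀ hm hlt.le 2
  have h3 : p * m ^ 2 ≤ p * (κ * u) ^ 2 := mul_le_mul_of_nonneg_left h2 hp.le
  have h4 : p * u * (u * κ ^ 2 + 1 / 500 * κ * n) < p * u * (999 / 1000 * n) :=
    mul_lt_mul_of_pos_left hκ (by positivity)
  nlinarith

lemma half_lt_ncard_restrictedBall {V : Type} [Fintype V] {G : SimpleGraph V} {p β : ℝ} {n : ℕ}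
    (hlog : 1000 ≤ Real.log n)
    (hpn : p ≥ 100 * Real.log n / n) (hβ : β ≤ 1 / 1000 * n * p)
    (hJ : IsJumbled G p β)
    (hd : ∀ v : V, ((G.neighborSet v).ncard : ℝ) ≥ (1 - 1 / 1000) * n * p)
    {R : Set (Sym2 V)} (hR : R ⊆ G.edgeSet)
    (hcut : ∀ A B : Set V, A ∪ B = Set.univ → Disjoint A B →
      (edgeCountBetween R A B : ℝ) ≥ (edgeCountBetween G.edgeSet A B : ℝ) / 2)
    {S : Set V} (hS : (S.ncard : ℝ) ≤ 2 * Real.log n) {v : V} (hv : v ∉ S) :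
    (n : ℝ) / 2 < (restrictedBall G R S v (⌊Real.log n / 3⌋₊ + 82)).ncard := by
  have hn : (0 : ℝ) < n := by
    rcases Nat.eq_zero_or_pos n with rfl | h
    · norm_num at hlog
    · exact_mod_cast h
  have hp : 0 < p := hJ.1
  have hnp : 100 * Real.log n ≤ n * p := by
    rw [ge_iff_le, div_le_iff₀ hn] at hpn
    linarith
  have hstep : ∀ i, ((restrictedBall G R S v i ∪
      outerNeighbors R (restrictedBall G R S v i)).ncard : ℝ) - 2 * Real.log n ≤
      (restrictedBall G R S v (i + 1)).ncard := by
    intro i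
    have h1 := Set.ncard_le_ncard (restrictedBall_subset_succ G hR S v i) (Set.toFinite _)
    have h2 := Set.ncard_le_ncard_sdiff_add_ncard (restrictedBall G R S v i ∪
      outerNeighbors R (restrictedBall G R S v i)) S (Set.toFinite _)
    have h3 : ((restrictedBall G R S v i ∪
      outerNeighbors R (restrictedBall G R S v i)).ncard : ℝ) ≤
      (restrictedBall G R S v (i + 1)).ncard + S.ncard := by exact_mod_cast (by omega)
    linarith
  set b : ℕ → ℝ := fun i => (restrictedBall G R S v i).ncard with hb
  have hmono : ∀ i, b i ≤ b (i + 1) := by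
    intro i
    simp only [hb]
    norm_cast
    refine Set.ncard_le_ncard ?_ (Set.toFinite _)
    rintro x ⟨q, h1, h2, h3⟩
    exact ⟨q, h1, h2, by omega⟩
  have hone : 20 * Real.log n ≤ b 1 := by
    have h0 : {v} ⊆ restrictedBall G R S v 0 := by
      simpa using mem_restrictedBall_self G R hv 0
    have h1 : outerNeighbors R {v} ⊆ restrictedBall G R S v 0 ∪
        outerNeighbors R (restrictedBall G R S v 0) := by
      rintro x ⟨-, y, hy, hyx⟩
      by_cases hx : x ∈ restrictedBall G R S v 0
      · exact Or.inl hx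
      · exact Or.inr ⟨hx, y, h0 hy, hyx⟩
    have h2 : ((outerNeighbors R {v}).ncard : ℝ) ≤ (restrictedBall G R S v 0 ∪
        outerNeighbors R (restrictedBall G R S v 0)).ncard := by
      exact_mod_cast Set.ncard_le_ncard h1 (Set.toFinite _)
    have h3 := half_le_ncard_outerNeighbors_singleton hd hcut v
    have h4 := hstep 0
    simp only [hb]
    norm_num at h4 ⊢
    nlinarith
  have hlow : ∀ i, 20 * Real.log n ≤ b (i + 1) := by
    intro i
    induction i with
    | zero => exact hone
    | succ i ih => exact ih.trans (hmono _)
  have hexp : ∀ i κ, b (i + 1) * κ ^ 2 + 1 / 500 * κ * n < 999 / 1000 * n →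
      κ * b (i + 1) - 2 * Real.log n ≤ b (i + 2) := by
    intro i κ hκ
    have h1 := mul_ncard_le_of_isJumbled hJ hd hR hcut (restrictedBall G R S v (i + 1))
    have h2 := mul_le_of_edge_bound hn hp hβ (by linarith [hlow i]) (Nat.cast_nonneg _) h1 hκ
    linarith [hstep (i + 1)]
  have hfast : ∀ k, (30 : ℝ) ^ k ≤ b (k + 1) ∨ n / 4000 ≤ b (k + 1) := by
    intro k
    induction k with
    | zero => left; norm_num; linarith
    | succ k ih =>
      rcases le_or_gt ((n : ℝ) / 4000) (b (k + 1)) with h | h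
      · exact Or.inr (h.trans (hmono _))
      · left
        have h1 := ih.resolve_right (not_le.2 h)
        have h2 := hexp k 31 (by linarith)
        rw [pow_succ]
        linarith [hlow k]
  have hslow : ∀ j k, n / 4000 ≤ b (k + 1) →
      (1.1 : ℝ) ^ j * (n / 4000) ≤ b (k + j + 1) ∨ (n : ℝ) / 2 < b (k + j + 1) := by
    intro j k hk
    induction j with
    | zero => left; simpa using hk
    | succ j ih =>
      rcases lt_or_ge ((n : ℝ) / 2) (b (k + j + 1)) with h | h
      · exact Or.inr (h.trans_le (hmono _))
      · left
        have h1 := ih.resolve_right (not_lt.2 h)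
        have h2 := hexp (k + j) 1.2 (by linarith)
        have h3 := hlow (k + j)
        rw [pow_succ]
        change _ ≤ b (k + j + 2)
        linarith
  have hk : (n : ℝ) / 4000 ≤ b (⌊Real.log n / 3⌋₊ + 1 + 1) := by
    rcases hfast (⌊Real.log n / 3⌋₊ + 1) with h | h
    · have h1 : Real.log n / 3 < (⌊Real.log n / 3⌋₊ + 1 : ℕ) := by
        exact_mod_cast Nat.lt_floor_add_one _
      have h3 : Real.exp 3 ≤ 30 := by
        have : Real.exp 3 = Real.exp 1 ^ 3 := by rw [← Real.exp_nat_mul]; norm_num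
        rw [this]
        have h4 := Real.exp_one_lt_d9
        calc Real.exp 1 ^ 3 ≤ 3 ^ 3 := by gcongr; linarith
          _ ≤ 30 := by norm_num
      have h2 : (n : ℝ) ≤ 30 ^ (⌊Real.log n / 3⌋₊ + 1) := by
        calc (n : ℝ) = Real.exp (Real.log n) := (Real.exp_log hn).symm
          _ ≤ Real.exp ((⌊Real.log n / 3⌋₊ + 1 : ℕ) * 3) := by
            apply Real.exp_le_exp.2; linarith
          _ = Real.exp 3 ^ (⌊Real.log n / 3⌋₊ + 1) := Real.exp_nat_mul _ _
          _ ≤ _ := by gcongr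
      linarith
    · exact h
  rcases hslow 80 _ hk with h | h
  · have h1 : (n : ℝ) / 2 < (1.1 : ℝ) ^ 80 * (n / 4000) := by
      have : (2000 : ℝ) < 1.1 ^ 80 := by norm_num
      nlinarith
    exact h1.trans_le h
  · exact h

theorem robust_small_diameter :
    ∃ ε C : ℝ, ε > 0 ∧ C > 1 ∧ ∃ N : ℕ, ∀ n : ℕ, n ≥ N →
      ∀ (V : Type) [Fintype V] [DecidableEq V] (G : SimpleGraph V) (p β : ℝ),
        Fintype.card V = n →
        p ≥ C * Real.log n / n → β ≤ ε * n * p →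
        IsJumbled G p β →
        (∀ v : V, ((G.neighborSet v).ncard : ℝ) ≥ (1 - ε) * n * p) →
        ∀ R : Set (Sym2 V), R ⊆ G.edgeSet →
        (∀ A B : Set V, A ∪ B = Set.univ → Disjoint A B →
          (edgeCountBetween R A B : ℝ) ≥ (edgeCountBetween G.edgeSet A B : ℝ) / 2) →
        ∀ S : Set V, (S.ncard : ℝ) ≤ 2 * Real.log n →
        ∀ v, v ∉ S → ∀ w, w ∉ S →
          ∃ q : G.Walk v w, q.IsPath ∧ (∀ e ∈ q.edges, e ∈ R) ∧
            (∀ u ∈ q.support, u ∉ S) ∧ (q.length : ℝ) ≤ Real.log n - 1 := by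
  refine ⟨1 / 1000, 100, by norm_num, by norm_num, ⌈Real.exp 1000⌉₊, ?_⟩
  intro n hnN V _ _ G p β hV hpn hβ hJ hd R hR hcut S hS v hv w hw
  have hexp : Real.exp 1000 ≤ n := (Nat.le_ceil _).trans (by exact_mod_cast hnN)
  have hn : (0 : ℝ) < n := (Real.exp_pos _).trans_le hexp
  have hlog : 1000 ≤ Real.log n := (Real.le_log_iff_exp_le hn).2 hexp
  have hbv := half_lt_ncard_restrictedBall hlog hpn hβ hJ hd hR hcut hS hv
  have hbw := half_lt_ncard_restrictedBall hlog hpn hβ hJ hd hR hcut hS hw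
  obtain ⟨z, ⟨a, haR, haS, hal⟩, ⟨c, hcR, hcS, hcl⟩⟩ :
      (restrictedBall G R S v (⌊Real.log n / 3⌋₊ + 82) ∩
        restrictedBall G R S w (⌊Real.log n / 3⌋₊ + 82)).Nonempty := by
    by_contra hempty
    rw [Set.not_nonempty_iff_eq_empty, ← Set.disjoint_iff_inter_eq_empty] at hempty
    have h1 := Set.ncard_union_eq hempty (Set.toFinite _) (Set.toFinite _)
    have h2 := Set.ncard_le_card (restrictedBall G R S v (⌊Real.log n / 3⌋₊ + 82) ∪
        restrictedBall G R S w (⌊Real.log n / 3⌋₊ + 82))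
    rw [h1, Nat.card_eq_fintype_card, hV] at h2
    have h3 : ((restrictedBall G R S v (⌊Real.log n / 3⌋₊ + 82)).ncard : ℝ) +
        (restrictedBall G R S w (⌊Real.log n / 3⌋₊ + 82)).ncard ≤ n := by exact_mod_cast h2
    linarith
  refine ⟨(a.append c.reverse).bypass, Walk.bypass_isPath _, ?_, ?_, ?_⟩
  · intro e he
    have h := Walk.edges_bypass_subset_edges _ he
    rw [Walk.edges_append, Walk.edges_reverse, List.mem_append, List.mem_reverse] at h
    exact h.elim (haR e) (hcR e)
  · intro u hu
    have h := Walk.support_bypass_subset_support _ hu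
    rw [Walk.mem_support_append_iff, Walk.support_reverse, List.mem_reverse] at h
    exact h.elim (haS u) (hcS u)
  · have h1 := Walk.length_bypass_le_length (a.append c.reverse)
    rw [Walk.length_append, Walk.length_reverse] at h1
    have h2 : ((a.append c.reverse).bypass.length : ℝ) ≤
        2 * ((⌊Real.log n / 3⌋₊ : ℕ) + 82) := by exact_mod_cast (by omega)
    have h3 := Nat.floor_le (show 0 ≤ Real.log n / 3 by linarith)
    linarith
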